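/- Let d = 2, let κ ≥ 1 and let n ≥ 1. Let r be a positive integer and let x_0,…,x_r ∈ (1/n)ℤ² and u_0,…,u_r ∈ ℝ² be sequences with u_0 = 0 such that, for each 0 ≤ i < r, there exist k ∈ {1,2}, nonzero vectors v_1,…,v_k ∈ ℤ² with ‖v_j‖ ≤ 2κ for all j and, if k = 2, |det(v_1,v_2)| = 1, and coefficients α_1,…,α_k > 0 with α_1 + ⋯ + α_k = 1, such that, setting v := (α_1 v_1 + ⋯ + α_k v_k)/n, the pair (λ, j) ∈ ℝ_+ × {1,…,k} minimizing ‖x_i + u_i + λv − (x_i + v_j/n)‖ satisfies x_{i+1} = x_i + v_j/n and u_{i+1} = x_i + u_i + λv − x_{i+1}. Let γ : [0,r] → ℝ² be the piecewise linear path with γ(i) = x_i + u_i for each integer i, affine on each interval [i, i+1]. Then there is an absolute constant C such that ‖γ(t) − x_{⌊t⌋}‖ ≤ C·κ³/n for all t ∈ [0,r]. -/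

import Mathlib

open Matrix
open scoped BigOperators ENNReal Classical

noncomputable section

/-- Euclidean norm of a vector of `ℝ^d`. -/
def euclNorm {d : ℕ} (u : Fin d → ℝ) : ℝ := Real.sqrt (u ⬝ᵥ u)

/-- The norm `‖u‖_M := √(uᵀ M u)` associated to a matrix `M`. -/
def normM {d : ℕ} (M : Matrix (Fin d) (Fin d) ℝ) (u : Fin d → ℝ) : ℝ :=
  Real.sqrt (u ⬝ᵥ M.mulVec u)

/-- Operator norm of a matrix, with respect to the euclidean norm. -/
def opNorm {d : ℕ} (M : Matrix (Fin d) (Fin d) ℝ) : ℝ :=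
  sSup {r : ℝ | ∃ u : Fin d → ℝ, euclNorm u = 1 ∧ r = euclNorm (M.mulVec u)}

/-- Anisotropy ratio `κ(M) := max ‖u‖_M/‖v‖_M` over euclidean-unit vectors `u, v`. -/
def kappa {d : ℕ} (M : Matrix (Fin d) (Fin d) ℝ) : ℝ :=
  sSup {r : ℝ | ∃ u v : Fin d → ℝ,
    euclNorm u = 1 ∧ euclNorm v = 1 ∧ r = normM M u / normM M v}

/-- `z` has integer coordinates, i.e. `z ∈ ℤ^d`. -/
def IsIntVec {d : ℕ} (z : Fin d → ℝ) : Prop := ∀ i, ∃ m : ℤ, z i = (m : ℝ)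

/-- `z` belongs to the sub-lattice `u_0 ℤ + ⋯ + u_{k-1} ℤ` generated by the
first `k` vectors of the family `u`. -/
def InLatticeSpan {d : ℕ} (u : Fin d → Fin d → ℝ) (k : ℕ) (z : Fin d → ℝ) : Prop :=
  ∃ c : Fin d → ℤ, (∀ i : Fin d, ¬ ((i : ℕ) < k) → c i = 0) ∧ z = ∑ i, (c i : ℝ) • u i

/-- `u` is an `M`-reduced basis of `ℤ^d`: a basis of the lattice `ℤ^d`
(integer entries, determinant `±1`) such that each `u k` minimizes `‖·‖_M`
among integer vectors outside the sub-lattice spanned by `u 0, …, u (k-1)`. -/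
def IsReducedBasis {d : ℕ} (M : Matrix (Fin d) (Fin d) ℝ) (u : Fin d → Fin d → ℝ) : Prop :=
  (∀ i, IsIntVec (u i)) ∧ |(Matrix.of u).det| = 1 ∧
  ∀ k : Fin d, ∀ z : Fin d → ℝ, IsIntVec z → ¬ InLatticeSpan u (k : ℕ) z →
    normM M (u k) ≤ normM M z

/-- A simplex of `ℝ^d`, described by its vertex set: `d+1` affinely independent points. -/
def IsSimplex (d : ℕ) (V : Finset (Fin d → ℝ)) : Prop :=
  V.card = d + 1 ∧ AffineIndependent ℝ (fun v : V => (v : Fin d → ℝ))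

/-- A (conforming) mesh: a finite collection of simplices such that the intersection
of any two of them is the convex hull of their common vertices. -/
def IsMesh (d : ℕ) (𝒯 : Finset (Finset (Fin d → ℝ))) : Prop :=
  (∀ V ∈ 𝒯, IsSimplex d V) ∧
  ∀ S ∈ 𝒯, ∀ T ∈ 𝒯,
    (convexHull ℝ (S : Set (Fin d → ℝ))) ∩ (convexHull ℝ (T : Set (Fin d → ℝ)))
      = convexHull ℝ ((S ∩ T : Finset (Fin d → ℝ)) : Set (Fin d → ℝ))

/-- An `M`-reduced mesh. -/
def IsReducedMesh {d : ℕ} (M : Matrix (Fin d) (Fin d) ℝ)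
    (𝒯 : Finset (Finset (Fin d → ℝ))) : Prop :=
  IsMesh d 𝒯 ∧
  (⋃ V ∈ 𝒯, convexHull ℝ (V : Set (Fin d → ℝ))) ∈ nhds (0 : Fin d → ℝ) ∧
  (∀ V ∈ 𝒯, ∀ v ∈ V, IsIntVec v) ∧
  (∀ V ∈ 𝒯, MeasureTheory.volume (convexHull ℝ (V : Set (Fin d → ℝ)))
      = ENNReal.ofReal (1 / (Nat.factorial d))) ∧
  (∀ V ∈ 𝒯, (0 : Fin d → ℝ) ∈ V) ∧
  (∀ V ∈ 𝒯, ∀ v ∈ V, ∀ w ∈ V, v ≠ 0 → w ≠ 0 → 0 ≤ v ⬝ᵥ M.mulVec w)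

/-- `z` is a vertex of the mesh `𝒯`. -/
def IsMeshVertex {d : ℕ} (𝒯 : Finset (Finset (Fin d → ℝ))) (z : Fin d → ℝ) : Prop :=
  ∃ V ∈ 𝒯, z ∈ V

/-- The multiplicative distance `d_×(M,N) := sup_{u ≠ 0} |ln ‖u‖_M − ln ‖u‖_N|`. -/
def dTimes {d : ℕ} (M N : Matrix (Fin d) (Fin d) ℝ) : ℝ :=
  sSup {r : ℝ | ∃ u : Fin d → ℝ, u ≠ 0 ∧ r = |Real.log (normM M u) - Real.log (normM N u)|}

/-- The periodic unit box `Ω = (ℝ/ℤ)^d`. -/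
abbrev Torus (d : ℕ) : Type := Fin d → AddCircle (1 : ℝ)

/-- Canonical projection `ℝ^d → (ℝ/ℤ)^d`. -/
def toTorus {d : ℕ} (x : Fin d → ℝ) : Torus d := fun i => (x i : AddCircle (1 : ℝ))

/-- The grid `Ω_n = {0, 1/n, …, (n-1)/n}^d ⊂ Ω`. -/
def IsGridPoint {d : ℕ} (n : ℕ) (z : Torus d) : Prop :=
  ∃ k : Fin d → ℤ, ∀ i, z i = (((k i : ℝ) / (n : ℝ) : ℝ) : AddCircle (1 : ℝ))

/-- The quotient (periodic) distance on the torus. -/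
def dPer {d : ℕ} (z x : Torus d) : ℝ :=
  sInf {r : ℝ | ∃ Z X : Fin d → ℝ, toTorus Z = z ∧ toTorus X = x ∧ r = euclNorm (Z - X)}

/-- The Hopf–Lax update operator associated to the matrix `M`, the stencil (mesh) `𝒯`,
and the grid scale `1/n`: minimum over simplices `T ∈ 𝒯`, and over barycentric
coefficients `α ≥ 0` supported on the nonzero vertices of `T` with total mass 1, of
`‖∑ α_v v/n‖_M + ∑ α_v u(z + v/n)` (with the convention `0·∞ = 0`). -/
def hopfLax {d : ℕ} (M : Matrix (Fin d) (Fin d) ℝ) (𝒯 : Finset (Finset (Fin d → ℝ)))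
    (n : ℕ) (u : Torus d → ℝ≥0∞) (z : Torus d) : ℝ≥0∞ :=
  ⨅ (T : Finset (Fin d → ℝ)) (_ : T ∈ 𝒯) (α : (Fin d → ℝ) → ℝ)
    (_ : ∀ w, 0 ≤ α w) (_ : α 0 = 0) (_ : ∑ w ∈ T, α w = 1),
    ENNReal.ofReal (normM M ((n : ℝ)⁻¹ • ∑ w ∈ T, α w • w)) +
      ∑ w ∈ T, ENNReal.ofReal (α w) * u (z + toTorus ((n : ℝ)⁻¹ • w))

/-- `u` solves the discrete fixed point system: `u(0) = 0` and
`u(z) = Λ_n(u,z)` at every other grid point `z`. -/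
def SolvesDiscrete {d : ℕ} (𝓜 : Torus d → Matrix (Fin d) (Fin d) ℝ)
    (𝒯 : Torus d → Finset (Finset (Fin d → ℝ))) (n : ℕ) (u : Torus d → ℝ≥0∞) : Prop :=
  u 0 = 0 ∧ ∀ z : Torus d, IsGridPoint n z → z ≠ 0 → u z = hopfLax (𝓜 z) (𝒯 z) n u z


/-- One step of the minimal path extraction algorithm (dimension 2): at step `i`, the
direction `v = (α₁v₁ + ⋯ + α_k v_k)/n` is a convex combination with positive weights of
`k ∈ {1,2}` nonzero integer vectors of euclidean norm at most `2κ` (with `|det(v₁,v₂)| = 1`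
when `k = 2`), and `(λ, j)` minimizing `‖x_i + u_i + λv - (x_i + v_j/n)‖` over
`λ ∈ ℝ₊` and `1 ≤ j ≤ k` satisfies `x_{i+1} = x_i + v_j/n` and
`u_{i+1} = x_i + u_i + λv - x_{i+1}`. -/
def PathStep (κ : ℝ) (n : ℕ) (x u : ℕ → Fin 2 → ℝ) (i : ℕ) : Prop :=
  (∃ v₁ : Fin 2 → ℝ, IsIntVec v₁ ∧ v₁ ≠ 0 ∧ euclNorm v₁ ≤ 2 * κ ∧
    ∃ lam : ℝ, 0 ≤ lam ∧
      (∀ lam' : ℝ, 0 ≤ lam' →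
        euclNorm (x i + u i + lam • ((n : ℝ)⁻¹ • v₁) - (x i + (n : ℝ)⁻¹ • v₁))
          ≤ euclNorm (x i + u i + lam' • ((n : ℝ)⁻¹ • v₁) - (x i + (n : ℝ)⁻¹ • v₁))) ∧
      x (i + 1) = x i + (n : ℝ)⁻¹ • v₁ ∧
      u (i + 1) = x i + u i + lam • ((n : ℝ)⁻¹ • v₁) - x (i + 1)) ∨
  (∃ v₁ v₂ : Fin 2 → ℝ, IsIntVec v₁ ∧ IsIntVec v₂ ∧ v₁ ≠ 0 ∧ v₂ ≠ 0 ∧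
    euclNorm v₁ ≤ 2 * κ ∧ euclNorm v₂ ≤ 2 * κ ∧
    |v₁ 0 * v₂ 1 - v₁ 1 * v₂ 0| = 1 ∧
    ∃ α₁ α₂ : ℝ, 0 < α₁ ∧ 0 < α₂ ∧ α₁ + α₂ = 1 ∧
    ∃ lam : ℝ, 0 ≤ lam ∧ ∃ vj ∈ ({v₁, v₂} : Set (Fin 2 → ℝ)),
      (∀ lam' : ℝ, 0 ≤ lam' → ∀ vj' ∈ ({v₁, v₂} : Set (Fin 2 → ℝ)),
        euclNorm (x i + u i + lam • ((n : ℝ)⁻¹ • (α₁ • v₁ + α₂ • v₂))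
            - (x i + (n : ℝ)⁻¹ • vj))
          ≤ euclNorm (x i + u i + lam' • ((n : ℝ)⁻¹ • (α₁ • v₁ + α₂ • v₂))
            - (x i + (n : ℝ)⁻¹ • vj'))) ∧
      x (i + 1) = x i + (n : ℝ)⁻¹ • vj ∧
      u (i + 1) = x i + u i + lam • ((n : ℝ)⁻¹ • (α₁ • v₁ + α₂ • v₂)) - x (i + 1))

set_option maxHeartbeats 2000000 in
lemma core_step (κ p q a0 a1 b0 b1 α β ε : ℝ) (hκ : 1 ≤ κ)
    (ha : a0 ^ 2 + a1 ^ 2 ≤ 4 * κ ^ 2) (hb : b0 ^ 2 + b1 ^ 2 ≤ 4 * κ ^ 2)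
    (hε : ε ^ 2 = 1) (hdet : b0 * a1 - b1 * a0 = ε) (hα : 0 < α) (hβ : 0 < β)
    (hab : α + β = 1)
    (hD0 : 0 ≤ ε * ((α * a0 + β * b0) * q - (α * a1 + β * b1) * p))
    (hU : 256 * κ ^ 6 ≤ p ^ 2 + q ^ 2) :
    ∃ l : ℝ, 0 ≤ l ∧
      ((p + l * (α * a0 + β * b0) - a0) ^ 2 + (q + l * (α * a1 + β * b1) - a1) ^ 2
          ≤ p ^ 2 + q ^ 2 ∨
       (p + l * (α * a0 + β * b0) - b0) ^ 2 + (q + l * (α * a1 + β * b1) - b1) ^ 2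
          ≤ p ^ 2 + q ^ 2) := by
  obtain ⟨x, hx⟩ : ∃ x, x = α * a0 + β * b0 := ⟨_, rfl⟩
  obtain ⟨y, hy⟩ : ∃ y, y = α * a1 + β * b1 := ⟨_, rfl⟩
  rw [← hx, ← hy] at hD0
  rw [← hx, ← hy]
  obtain ⟨V, hV⟩ : ∃ V, V = x ^ 2 + y ^ 2 := ⟨_, rfl⟩
  obtain ⟨a, haa⟩ : ∃ a, a = p * x + q * y := ⟨_, rfl⟩
  obtain ⟨D, hD⟩ : ∃ D, D = ε * (x * q - y * p) := ⟨_, rfl⟩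
  obtain ⟨c, hc⟩ : ∃ c, c = a0 * x + a1 * y := ⟨_, rfl⟩
  obtain ⟨d, hd⟩ : ∃ d, d = b0 * x + b1 * y := ⟨_, rfl⟩
  rw [← hD] at hD0
  have hκ0 : 0 < κ := by linarith
  have hva : x * a1 - y * a0 = β * ε := by rw [hx, hy, ← hdet]; ring
  have hvb : x * b1 - y * b0 = - (α * ε) := by rw [hx, hy, ← hdet]; ring
  -- lower bound on V
  have hV16 : 1 ≤ 16 * κ ^ 2 * V := by
    have e1 : (x * (a1 - b1) - y * (a0 - b0)) = ε := by
      have : x * (a1 - b1) - y * (a0 - b0) = (x * a1 - y * a0) - (x * b1 - y * b0) := by ring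
      rw [this, hva, hvb]; linear_combination ε * hab
    have e2 : (x * (a1 - b1) - y * (a0 - b0)) ^ 2 ≤ V * ((a0 - b0) ^ 2 + (a1 - b1) ^ 2) := by
      rw [hV]; linarith [sq_nonneg (x * (a0 - b0) + y * (a1 - b1))]
    rw [e1, hε] at e2
    have e3 : (a0 - b0) ^ 2 + (a1 - b1) ^ 2 ≤ 16 * κ ^ 2 := by
      linarith [sq_nonneg (a0 + b0), sq_nonneg (a1 + b1)]
    have hV0 : 0 ≤ V := by rw [hV]; positivity
    linarith [mul_le_mul_of_nonneg_left e3 hV0]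
  have hVpos : 0 < V := by
    by_contra h
    have : 16 * κ ^ 2 * V ≤ 0 := mul_nonpos_of_nonneg_of_nonpos (by positivity) (not_lt.mp h)
    linarith
  have hk2 : 1 ≤ κ ^ 2 := one_le_pow₀ hκ
  have hk4 : 1 ≤ κ ^ 4 := one_le_pow₀ hκ
  have hk3 : 1 ≤ κ ^ 3 := one_le_pow₀ hκ
  have hk26 : κ ^ 2 ≤ κ ^ 6 := pow_le_pow_right₀ hκ (by norm_num)
  have hUV : V * (p ^ 2 + q ^ 2) = a ^ 2 + D ^ 2 := by
    rw [hV, haa, hD, mul_pow, hε]; ring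
  have haV : V * (a0 ^ 2 + a1 ^ 2) = c ^ 2 + β ^ 2 := by
    have : V * (a0 ^ 2 + a1 ^ 2) = c ^ 2 + (x * a1 - y * a0) ^ 2 := by rw [hV, hc]; ring
    rw [this, hva, mul_pow, hε, mul_one]
  have hbV : V * (b0 ^ 2 + b1 ^ 2) = d ^ 2 + α ^ 2 := by
    have : V * (b0 ^ 2 + b1 ^ 2) = d ^ 2 + (x * b1 - y * b0) ^ 2 := by rw [hV, hd]; ring
    rw [this, hvb, neg_sq, mul_pow, hε, mul_one]
  have hUa : V * (p * a0 + q * a1) = a * c + D * β := by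
    have : V * (p * a0 + q * a1) = a * c + (x * q - y * p) * (x * a1 - y * a0) := by
      rw [hV, haa, hc]; ring
    rw [this, hva, hD]; ring
  have hcd : α * c + β * d = V := by rw [hc, hd, hV, hx, hy]; ring
  by_cases hA : 2 * κ ^ 2 ≤ a
  · -- averaging
    refine ⟨0, le_rfl, ?_⟩
    by_contra h
    push Not at h
    obtain ⟨h1, h2⟩ := h
    have h1' : 0 < α * ((p + 0 * x - a0) ^ 2 + (q + 0 * y - a1) ^ 2 - (p ^ 2 + q ^ 2)) :=
      mul_pos hα (by linarith)
    have h2' : 0 < β * ((p + 0 * x - b0) ^ 2 + (q + 0 * y - b1) ^ 2 - (p ^ 2 + q ^ 2)) :=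
      mul_pos hβ (by linarith)
    have h3 := mul_le_mul_of_nonneg_left ha hα.le
    have h4 := mul_le_mul_of_nonneg_left hb hβ.le
    have h5 : α * (4 * κ ^ 2) + β * (4 * κ ^ 2) = 4 * κ ^ 2 := by rw [← add_mul, hab, one_mul]
    have h6 : a = α * (p * a0 + q * a1) + β * (p * b0 + q * b1) := by rw [haa, hx, hy]; ring
    have h7 : α * ((p + 0 * x - a0) ^ 2 + (q + 0 * y - a1) ^ 2 - (p ^ 2 + q ^ 2))
      = α * (a0 ^ 2 + a1 ^ 2) - 2 * (α * (p * a0 + q * a1)) := by ring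
    have h8 : β * ((p + 0 * x - b0) ^ 2 + (q + 0 * y - b1) ^ 2 - (p ^ 2 + q ^ 2))
      = β * (b0 ^ 2 + b1 ^ 2) - 2 * (β * (p * b0 + q * b1)) := by ring
    linarith
  push Not at hA
  by_cases hB : a ≤ c
  · refine ⟨(c - a) / V, div_nonneg (by linarith) hVpos.le, Or.inl ?_⟩
    obtain ⟨l, hl⟩ : ∃ l, l = (c - a) / V := ⟨_, rfl⟩
    rw [← hl]
    have hlV : l * V = c - a := by rw [hl]; field_simp
    have e1 : V * ((p + l * x - a0) ^ 2 + (q + l * y - a1) ^ 2) = (D - β) ^ 2 := by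
      have i1 : (p + l * x - a0) * x + (q + l * y - a1) * y = 0 := by
        have : (p + l * x - a0) * x + (q + l * y - a1) * y = a + l * V - c := by
          rw [haa, hV, hc]; ring
        rw [this, hlV]; ring
      have i2 : ε * (x * (q + l * y - a1) - y * (p + l * x - a0)) = D - β := by
        have : ε * (x * (q + l * y - a1) - y * (p + l * x - a0))
          = ε * (x * q - y * p) - ε * (x * a1 - y * a0) := by ring
        rw [this, hva, ← hD]; linear_combination (-β) * hε
      have : V * ((p + l * x - a0) ^ 2 + (q + l * y - a1) ^ 2) =
        ((p + l * x - a0) * x + (q + l * y - a1) * y) ^ 2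
         + (x * (q + l * y - a1) - y * (p + l * x - a0)) ^ 2 := by rw [hV]; ring
      rw [this, i1, ← i2, mul_pow, hε]; ring
    refine le_of_mul_le_mul_left ?_ hVpos
    rw [e1]
    by_cases h : β ≤ 2 * D
    · rw [hUV]; linarith [sq_nonneg a, mul_nonneg hβ.le (by linarith : 0 ≤ 2 * D - β)]
    · push Not at h
      have f1 : (D - β) ^ 2 ≤ 1 := (sq_le_one_iff_abs_le_one _).mpr (abs_le.mpr ⟨by linarith, by linarith⟩)
      have f2 : V * (16 * κ ^ 2) ≤ V * (p ^ 2 + q ^ 2) :=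
        mul_le_mul_of_nonneg_left (by linarith) hVpos.le
      linarith
  push Not at hB
  refine ⟨0, le_rfl, Or.inl ?_⟩
  suffices hs : V * (a0 ^ 2 + a1 ^ 2) ≤ 2 * (V * (p * a0 + q * a1)) by
    have : a0 ^ 2 + a1 ^ 2 ≤ 2 * (p * a0 + q * a1) :=
      le_of_mul_le_mul_left (by linarith) hVpos
    linarith
  have hc2 : c ^ 2 ≤ 4 * κ ^ 2 * V := by
    linarith [mul_le_mul_of_nonneg_left ha hVpos.le, sq_nonneg β]
  have hd2 : d ^ 2 ≤ 4 * κ ^ 2 * V := by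
    linarith [mul_le_mul_of_nonneg_left hb hVpos.le, sq_nonneg α]
  obtain ⟨s, hs⟩ : ∃ s, s = Real.sqrt V := ⟨_, rfl⟩
  have hs0 : 0 < s := by rw [hs]; exact Real.sqrt_pos.mpr hVpos
  have hss : s ^ 2 = V := by rw [hs]; exact Real.sq_sqrt hVpos.le
  have ha2 : a ^ 2 ≤ 64 * κ ^ 6 * V := by
    by_cases h : 0 ≤ a
    · have h1 : a ^ 2 ≤ (2 * κ ^ 2) ^ 2 := pow_le_pow_left₀ h hA.le 2
      have h2 : 4 * κ ^ 4 * 1 ≤ 4 * κ ^ 4 * (16 * κ ^ 2 * V) :=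
        mul_le_mul_of_nonneg_left hV16 (by positivity)
      linarith
    · push Not at h
      have h1 : a ^ 2 ≤ c ^ 2 := sq_le_sq.mpr (by rw [abs_of_neg h, abs_of_neg (hB.trans h)]; linarith)
      linarith [mul_le_mul_of_nonneg_right hk26 hVpos.le]
  have hDs : 12 * κ ^ 3 * s ≤ D := by
    apply abs_le_of_sq_le_sq' _ hD0 |>.2
    have : (12 * κ ^ 3 * s) ^ 2 = 144 * κ ^ 6 * V := by rw [← hss]; ring
    rw [this]
    have := mul_le_mul_of_nonneg_left hU hVpos.le
    linarith [mul_pos (pow_pos hκ0 6) hVpos]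
  have hs4 : 1 ≤ 4 * κ * s := by
    apply abs_le_of_sq_le_sq' _ (by positivity) |>.2
    have e : (4 * κ * s) ^ 2 = 16 * κ ^ 2 * V := by rw [← hss]; ring
    linarith
  rw [hUa]
  by_cases hC : 0 ≤ c
  · rw [haV]
    have h0 : 12 * κ ^ 3 * s = 3 * κ ^ 2 * (4 * κ * s) := by ring
    have h01 : 3 * κ ^ 2 * 1 ≤ 3 * κ ^ 2 * (4 * κ * s) :=
      mul_le_mul_of_nonneg_left hs4 (by positivity)
    have h1 : 3 ≤ D := by linarith
    have h2 : c * c ≤ a * c := mul_le_mul_of_nonneg_right hB.le hC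
    have h3 : β * β ≤ D * β := mul_le_mul_of_nonneg_right (by linarith) hβ.le
    have h4 : 0 ≤ β * β := mul_self_nonneg β
    have h5 : 0 ≤ c * c := mul_self_nonneg c
    rw [sq, sq]
    linarith
  · push Not at hC
    have hd1 : d ≤ 2 * κ * s := by
      apply abs_le_of_sq_le_sq' _ (by positivity) |>.2
      have e : (2 * κ * s) ^ 2 = 4 * κ ^ 2 * V := by rw [← hss]; ring
      linarith [neg_sq c]
    have hc1 : -c ≤ 2 * κ * s := by
      apply abs_le_of_sq_le_sq' _ (by positivity) |>.2
      have e : (2 * κ * s) ^ 2 = 4 * κ ^ 2 * V := by rw [← hss]; ring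
      linarith [neg_sq c]
    have k1 := mul_le_mul_of_nonneg_left hd1 hβ.le
    have k2 := mul_neg_of_pos_of_neg hα hC
    have e0 : 2 * κ * s * β = β * (2 * κ * s) := by ring
    have e0' : 4 * κ * s * β = 2 * (β * (2 * κ * s)) := by ring
    have g1 : V ≤ 2 * κ * s * β := by linarith
    have g2 : -c ≤ 4 * κ * s * β := by
      have : -c = α * (-c) + β * (-c) := by rw [← add_mul, hab, one_mul]
      have k3 := mul_le_mul_of_nonneg_left hc1 hβ.le
      have k4 : α * -c = - (α * c) := by ring
      linarith
    have g3 : V * (a0 ^ 2 + a1 ^ 2) ≤ 8 * κ ^ 3 * s * β := by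
      have := mul_le_mul_of_nonneg_left ha hVpos.le
      have := mul_le_mul_of_nonneg_right g1 (by positivity : 0 ≤ 4 * κ ^ 2)
      have e : 2 * κ * s * β * (4 * κ ^ 2) = 8 * κ ^ 3 * s * β := by ring
      linarith
    have g4 : a * (-c) ≤ 8 * κ ^ 3 * s * β := by
      have h1 : a * (-c) ≤ 2 * κ ^ 2 * (-c) := mul_le_mul_of_nonneg_right hA.le (by linarith)
      have h2 := mul_le_mul_of_nonneg_left g2 (by positivity : 0 ≤ 2 * κ ^ 2)
      have e : 2 * κ ^ 2 * (4 * κ * s * β) = 8 * κ ^ 3 * s * β := by ring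
      linarith
    have g5 := mul_le_mul_of_nonneg_right hDs hβ.le
    have e1 : 12 * κ ^ 3 * s * β = 12 * (κ ^ 3 * s * β) := by ring
    have e2 : 8 * κ ^ 3 * s * β = 8 * (κ ^ 3 * s * β) := by ring
    have e3 : a * -c = - (a * c) := by ring
    linarith

lemma core_step' (κ p q a0 a1 b0 b1 α β : ℝ) (hκ : 1 ≤ κ)
    (ha : a0 ^ 2 + a1 ^ 2 ≤ 4 * κ ^ 2) (hb : b0 ^ 2 + b1 ^ 2 ≤ 4 * κ ^ 2)
    (hdet : |a0 * b1 - a1 * b0| = 1) (hα : 0 < α) (hβ : 0 < β)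
    (hab : α + β = 1)
    (hU : 256 * κ ^ 6 ≤ p ^ 2 + q ^ 2) :
    ∃ l : ℝ, 0 ≤ l ∧
      ((p + l * (α * a0 + β * b0) - a0) ^ 2 + (q + l * (α * a1 + β * b1) - a1) ^ 2
          ≤ p ^ 2 + q ^ 2 ∨
       (p + l * (α * a0 + β * b0) - b0) ^ 2 + (q + l * (α * a1 + β * b1) - b1) ^ 2
          ≤ p ^ 2 + q ^ 2) := by
  have hε : (b0 * a1 - b1 * a0) ^ 2 = 1 := by
    have h : (a0 * b1 - a1 * b0) ^ 2 = 1 := by rw [← sq_abs, hdet]; norm_num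
    rw [← h]; ring
  by_cases h : 0 ≤ (b0 * a1 - b1 * a0) * ((α * a0 + β * b0) * q - (α * a1 + β * b1) * p)
  · exact core_step κ p q a0 a1 b0 b1 α β _ hκ ha hb hε rfl hα hβ hab h hU
  · obtain ⟨l, hl, H⟩ := core_step κ p q b0 b1 a0 a1 β α (a0 * b1 - a1 * b0) hκ hb ha
      (by rw [← hε]; ring) rfl hβ hα (by linarith) (by nlinarith) hU
    rw [add_comm (β * b0), add_comm (β * b1)] at H
    exact ⟨l, hl, H.symm⟩

lemma euclNorm_eq {d : ℕ} (w : Fin d → ℝ) : euclNorm w = ‖WithLp.toLp 2 w‖ := by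
  rw [euclNorm, EuclideanSpace.norm_eq]
  simp [dotProduct, sq]

lemma euclNorm_add_le {d : ℕ} (w z : Fin d → ℝ) :
    euclNorm (w + z) ≤ euclNorm w + euclNorm z := by
  simp only [euclNorm_eq, WithLp.toLp_add]; exact norm_add_le _ _

lemma euclNorm_sub_le {d : ℕ} (w z : Fin d → ℝ) :
    euclNorm (w - z) ≤ euclNorm w + euclNorm z := by
  simp only [euclNorm_eq, WithLp.toLp_sub]; exact norm_sub_le _ _

lemma euclNorm_smul {d : ℕ} (c : ℝ) (hc : 0 ≤ c) (w : Fin d → ℝ) :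
    euclNorm (c • w) = c * euclNorm w := by
  simp only [euclNorm_eq, WithLp.toLp_smul, norm_smul, Real.norm_of_nonneg hc]

lemma euclNorm_nonneg' {d : ℕ} (w : Fin d → ℝ) : 0 ≤ euclNorm w := Real.sqrt_nonneg _

lemma euclNorm_sq2 (w : Fin 2 → ℝ) : euclNorm w ^ 2 = w 0 ^ 2 + w 1 ^ 2 := by
  rw [euclNorm, Real.sq_sqrt]
  · simp [dotProduct, Fin.sum_univ_two, sq]
  · simp only [dotProduct, Fin.sum_univ_two]; nlinarith [sq_nonneg (w 0), sq_nonneg (w 1)]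

/-- One step in rescaled variables. -/
lemma step_bound (κ : ℝ) (hκ : 1 ≤ κ) (n : ℕ) (hn : 1 ≤ n) (x u : ℕ → Fin 2 → ℝ) (i : ℕ)
    (h : PathStep κ n x u i) (hu : euclNorm (u i) ≤ 18 * κ ^ 3 / n) :
    euclNorm (u (i + 1)) ≤ 18 * κ ^ 3 / n ∧
      euclNorm (x (i + 1) - x i) ≤ 2 * κ / n := by
  have hn0 : (0 : ℝ) < n := by exact_mod_cast hn
  have hni : (0 : ℝ) ≤ (n : ℝ)⁻¹ := by positivity
  have hsm : ∀ w : Fin 2 → ℝ, euclNorm w ≤ 2 * κ →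
      euclNorm ((n : ℝ)⁻¹ • w) ≤ 2 * κ / n := by
    intro w hw
    rw [euclNorm_smul _ hni, div_eq_inv_mul]
    exact mul_le_mul_of_nonneg_left hw hni
  rcases h with ⟨v, -, -, hv, lam, -, hmin, hx, hu'⟩ |
    ⟨v, w, -, -, -, -, hv, hw, hdet, α, β, hα, hβ, hab, lam, -, vj, hvj, hmin, hx, hu'⟩
  · refine ⟨?_, by rw [hx, add_sub_cancel_left]; exact hsm v hv⟩
    rw [hu', hx]
    refine (hmin 1 zero_le_one).trans ?_
    rwa [one_smul, add_sub_add_right_eq_sub, add_sub_cancel_left]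
  · have hvjn : euclNorm vj ≤ 2 * κ := by
      rcases hvj with rfl | hvj
      · exact hv
      · rw [Set.mem_singleton_iff.mp hvj]; exact hw
    refine ⟨?_, by rw [hx, add_sub_cancel_left]; exact hsm vj hvjn⟩
    rw [hu', hx]
    by_cases hbig : 16 * κ ^ 3 / n ≤ euclNorm (u i)
    · have hsq : ∀ z : Fin 2 → ℝ, euclNorm z ≤ 2 * κ → z 0 ^ 2 + z 1 ^ 2 ≤ 4 * κ ^ 2 := by
        intro z hz
        rw [← euclNorm_sq2]
        have := pow_le_pow_left₀ (euclNorm_nonneg' z) hz 2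
        linarith [mul_pow 2 κ 2]
      have hU : 256 * κ ^ 6 ≤ (n * u i 0) ^ 2 + (n * u i 1) ^ 2 := by
        rw [div_le_iff₀ hn0] at hbig
        have := pow_le_pow_left₀ (by positivity) hbig 2
        rw [mul_pow (euclNorm _), euclNorm_sq2] at this
        nlinarith
      obtain ⟨l, hl, H⟩ := core_step' κ _ _ (v 0) (v 1) (w 0) (w 1) α β hκ (hsq v hv) (hsq w hw)
        hdet hα hβ hab hU
      have key : ∀ z : Fin 2 → ℝ, (n * u i 0 + l * (α * v 0 + β * w 0) - z 0) ^ 2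
          + (n * u i 1 + l * (α * v 1 + β * w 1) - z 1) ^ 2
            ≤ (n * u i 0) ^ 2 + (n * u i 1) ^ 2 →
          euclNorm (x i + u i + l • ((n : ℝ)⁻¹ • (α • v + β • w)) - (x i + (n : ℝ)⁻¹ • z))
            ≤ euclNorm (u i) := by
        intro z hz
        refine abs_le_of_sq_le_sq' ?_ (euclNorm_nonneg' _) |>.2
        rw [euclNorm_sq2, euclNorm_sq2]
        simp only [Pi.add_apply, Pi.sub_apply, Pi.smul_apply, smul_eq_mul]
        have := mul_le_mul_of_nonneg_left hz (sq_nonneg (n : ℝ)⁻¹)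
        have hnn : (n : ℝ)⁻¹ * n = 1 := inv_mul_cancel₀ hn0.ne'
        obtain ⟨m, hm⟩ : ∃ m, m = (n : ℝ)⁻¹ := ⟨_, rfl⟩
        rw [← hm] at this hnn ⊢
        have e1 : ∀ s t : ℝ, m ^ 2 * ((n * s) ^ 2 + (n * t) ^ 2) = s ^ 2 + t ^ 2 := by
          intro s t
          have : m ^ 2 * ((n * s) ^ 2 + (n * t) ^ 2) = (m * n) ^ 2 * (s ^ 2 + t ^ 2) := by ring
          rw [this, hnn]; ring
        rw [e1] at this
        refine le_trans (le_of_eq ?_) this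
        have e2 : ∀ X s A z' : ℝ, X + s + l * (m * A) - (X + m * z')
          = m * (n * s + l * A - z') := by
          intro X s A z'
          linear_combination (-s) * hnn
        rw [e2, e2]; ring
      refine le_trans ?_ hu
      rcases H with H | H
      · exact (hmin l hl v (by simp)).trans (key v H)
      · exact (hmin l hl w (by simp)).trans (key w H)
    · push Not at hbig
      refine (hmin 0 le_rfl vj hvj).trans ?_
      rw [zero_smul, add_zero, add_sub_add_left_eq_sub]
      refine (euclNorm_sub_le _ _).trans ?_
      have h1 := hsm vj hvjn
      have h2 : 2 * κ / n ≤ 2 * κ ^ 3 / n := by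
        have : κ ≤ κ ^ 3 := le_self_pow₀ hκ (by norm_num)
        gcongr
      have h3 : 18 * κ ^ 3 / (n : ℝ) = 16 * κ ^ 3 / n + 2 * κ ^ 3 / n := by ring
      linarith

/-- Proposition on minimal path extraction (dimension 2): the piecewise linear path `γ`
through the points `x_i + u_i` remains within distance `C·κ³/n` of the visited grid
points `x_{⌊t⌋}`, for an absolute constant `C`. -/
theorem stmt18 :
    ∃ C : ℝ, ∀ (κ : ℝ), 1 ≤ κ → ∀ (n : ℕ), 1 ≤ n → ∀ (r : ℕ), 1 ≤ r →
      ∀ (x u : ℕ → Fin 2 → ℝ),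
        u 0 = 0 →
        (∀ i : ℕ, i ≤ r → ∀ c : Fin 2, ∃ m : ℤ, x i c = (m : ℝ) / (n : ℝ)) →
        (∀ i : ℕ, i < r → PathStep κ n x u i) →
        ∀ γ : ℝ → Fin 2 → ℝ,
          (∀ i : ℕ, i < r → ∀ s : ℝ, 0 ≤ s → s ≤ 1 →
            γ ((i : ℝ) + s) = (1 - s) • (x i + u i) + s • (x (i + 1) + u (i + 1))) →
          ∀ t : ℝ, 0 ≤ t → t ≤ (r : ℝ) →
            euclNorm (γ t - x ⌊t⌋₊) ≤ C * κ ^ 3 / (n : ℝ) := by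
  refine ⟨20, ?_⟩
  intro κ hκ n hn r hr x u hu0 _ hstep γ hγ t ht0 htr
  have hn0 : (0 : ℝ) < n := by exact_mod_cast hn
  have hκ0 : 0 < κ := by linarith
  have hub : ∀ i, i ≤ r → euclNorm (u i) ≤ 18 * κ ^ 3 / n := by
    intro i
    induction i with
    | zero =>
      intro _
      rw [hu0]
      have : euclNorm (0 : Fin 2 → ℝ) = 0 := by simp [euclNorm]
      rw [this]; positivity
    | succ i ih =>
      intro hi
      exact (step_bound κ hκ n hn x u i (hstep i hi) (ih (by omega))).1
  have hle : 18 * κ ^ 3 / (n : ℝ) + 2 * κ / n ≤ 20 * κ ^ 3 / n := by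
    have : κ ≤ κ ^ 3 := le_self_pow₀ hκ (by norm_num)
    rw [← add_div]
    gcongr
    linarith
  have hpos : 0 ≤ 2 * κ / (n : ℝ) := by positivity
  rcases lt_or_eq_of_le htr with hlt | heq
  · have hi : ⌊t⌋₊ < r := (Nat.floor_lt ht0).mpr hlt
    have hf := Nat.floor_le ht0
    have hf' := Nat.lt_floor_add_one t
    generalize ⌊t⌋₊ = i at *
    obtain ⟨s, hs⟩ : ∃ s, s = t - i := ⟨_, rfl⟩
    have hs0 : 0 ≤ s := by linarith
    have hs1 : s ≤ 1 := by linarith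
    have hg := hγ i hi s hs0 hs1
    rw [show (i : ℝ) + s = t by linarith] at hg
    have e : γ t - x i = (1 - s) • u i + s • ((x (i + 1) - x i) + u (i + 1)) := by
      rw [hg]; ext c; simp; ring
    rw [e]
    have b := step_bound κ hκ n hn x u i (hstep i hi) (hub i hi.le)
    have b0 := hub i hi.le
    refine (euclNorm_add_le _ _).trans ?_
    rw [euclNorm_smul _ (by linarith), euclNorm_smul _ hs0]
    have b2 := (euclNorm_add_le (x (i + 1) - x i) (u (i + 1))).trans (add_le_add b.2 b.1)
    have c1 := mul_le_mul_of_nonneg_left b0 (by linarith : 0 ≤ 1 - s)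
    have c2 := mul_le_mul_of_nonneg_left b2 hs0
    have c3 := mul_le_mul_of_nonneg_right hs1 hpos
    linarith
  · have hg := hγ (r - 1) (by omega) 1 zero_le_one le_rfl
    have hr1 : r - 1 + 1 = r := by omega
    have hr2 : ((r - 1 : ℕ) : ℝ) + 1 = r := by exact_mod_cast hr1
    rw [hr1, hr2] at hg
    rw [heq, Nat.floor_natCast, hg]
    have e : (1 - (1 : ℝ)) • (x (r - 1) + u (r - 1)) + (1 : ℝ) • (x r + u r) - x r = u r := by
      ext c; simp
    rw [e]
    linarith [hub r le_rfl]


end
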